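/- Let (G,·) be a finite group and ψ an endomorphism of G. Then there exists a natural number n ≥ 1 such that, setting J = ker(ψⁿ) and I = ψⁿ(G): J is a normal subgroup of G, I is a subgroup of G, J ∩ I = {1}, every element of G can be written as j·i with j ∈ J and i ∈ I (so G is an internal semidirect product of J by I), ψⁿ(J) = {1} (ψ is nilpotent on J), and ψ restricts to a bijection (an automorphism) of I. -/

import Mathlib

theorem exists_idem_iterate {G : Type*} [Finite G] (f : G → G) :
    ∃ n : ℕ, 1 ≤ n ∧ ∀ x, f^[n] (f^[n] x) = f^[n] x := by
  obtain ⟨a, b, hab, h⟩ : ∃ a b : ℕ, a < b ∧ f^[a] = f^[b] := by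
    obtain ⟨a, b, hne, h⟩ := Finite.exists_ne_map_eq_of_infinite (fun n : ℕ => f^[n])
    rcases lt_or_gt_of_ne hne with h1 | h1
    · exact ⟨a, b, h1, h⟩
    · exact ⟨b, a, h1, h.symm⟩
  obtain ⟨p, rfl⟩ := Nat.exists_eq_add_of_lt hab
  have key : ∀ m, f^[m + a + (p + 1)] = f^[m + a] := by
    intro m
    rw [add_assoc, Function.iterate_add f m, Function.iterate_add f m, h, add_assoc a p 1]
  have key2 : ∀ k m, f^[m + a + k * (p + 1)] = f^[m + a] := by
    intro k
    induction k with
    | zero => intro m; simp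
    | succ k ih =>
      intro m
      have h1 := key (m + k * (p + 1))
      have h2 := ih m
      rw [← h2, show m + a + (k + 1) * (p + 1) = m + k * (p + 1) + a + (p + 1) by ring, h1]
      congr 1
      ring
  refine ⟨(a + 1) * (p + 1), Nat.succ_le_of_lt (by positivity), fun x => ?_⟩
  rw [← Function.iterate_add_apply]
  have h3 := key2 (a + 1) (a * p + p + 1)
  rw [show a * p + p + 1 + a = (a + 1) * (p + 1) by ring] at h3
  rw [h3]

/-- Fitting's Lemma for finite groups: For a finite group `G`
and an endomorphism `ψ`, there is `n ≥ 1` such that, with `J = ker(ψⁿ)` and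
`I = ψⁿ(G)`: `J` is normal, `I` is a subgroup, `J ∩ I = 1`, `G = J·I`,
`ψⁿ(J) = 1`, and `ψ` restricts to a bijection of `I`. -/
theorem stmt_18 {G : Type*} [Group G] [Finite G] (ψ : G →* G) :
    ∃ n : ℕ, 1 ≤ n ∧ ∃ J I : Subgroup G,
      (J : Set G) = {g : G | (⇑ψ)^[n] g = 1} ∧
      (I : Set G) = Set.range ((⇑ψ)^[n]) ∧
      J.Normal ∧
      J ⊓ I = ⊥ ∧
      (∀ g : G, ∃ j ∈ J, ∃ i ∈ I, g = j * i) ∧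
      (∀ j ∈ J, (⇑ψ)^[n] j = 1) ∧
      Set.BijOn ψ (I : Set G) (I : Set G) := by
  obtain ⟨n, hn, hid⟩ := exists_idem_iterate ψ
  obtain ⟨m, rfl⟩ := Nat.exists_eq_add_of_le' hn
  obtain ⟨e, he⟩ : ∃ e : G →* G, (⇑ψ)^[m + 1] = e :=
    ⟨((show Monoid.End G from ψ) ^ (m + 1) : Monoid.End G), (Monoid.End.coe_pow G (show Monoid.End G from ψ) (m + 1)).symm⟩
  have hc : ∀ k x, e ((⇑ψ)^[k] x) = (⇑ψ)^[k] (e x) := by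
    intro k x
    rw [← he, ← Function.iterate_add_apply, ← Function.iterate_add_apply, add_comm]
  have h1 : ∀ x, e x = (⇑ψ)^[m] (ψ x) := by
    intro x
    rw [← he, Function.iterate_succ_apply]
  have h2 : ∀ x, e x = ψ ((⇑ψ)^[m] x) := by
    intro x
    rw [← he, Function.iterate_succ_apply']
  refine ⟨m + 1, hn, e.ker, e.range, ?_⟩
  rw [he] at hid ⊢
  refine ⟨rfl, rfl, inferInstance, ?_, ?_, fun j hj => hj, ?_, ?_, ?_⟩
  · rw [eq_bot_iff]
    rintro x ⟨hx, y, rfl⟩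
    have hx' : e (e y) = 1 := hx
    rw [hid] at hx'
    exact hx'
  · intro g
    refine ⟨g * (e g)⁻¹, ?_, e g, ⟨g, rfl⟩, by simp⟩
    simp [MonoidHom.mem_ker, hid]
  · rintro _ ⟨x, rfl⟩
    exact ⟨ψ x, hc 1 x⟩
  · rintro _ ⟨x, rfl⟩ _ ⟨y, rfl⟩ hxy
    rw [← hid x, ← hid y, h1 (e x), h1 (e y), hxy]
  · rintro _ ⟨x, rfl⟩
    exact ⟨e ((⇑ψ)^[m] x), ⟨_, rfl⟩, by rw [hc, ← h2, hid]⟩
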